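/- Let D be a PvMD such that every nonzero ideal I of D with (D : I) = D is t-idempotent. Then every branched t-maximal ideal of D is t-sharp. -/

import Mathlib

/-! Statement 12: Let D be a PvMD such that every nonzero ideal I with (D : I) = D is t-idempotent. Then every branched t-maximal ideal of D is t-sharp. -/

noncomputable section

/-- The image of an ideal of `D` in the fraction field of `D`, as a `D`-submodule. -/
def coeI (D : Type*) [CommRing D] [IsDomain D] (I : Ideal D) :
    Submodule D (FractionRing D) :=
  Submodule.map (Algebra.linearMap D (FractionRing D)) I

/-- The `v`-operation on `D`-submodules of the fraction field `K`:
`E^v = (E⁻¹)⁻¹`, where `E⁻¹ = (D : E) = {x ∈ K : xE ⊆ D}`. -/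
def vSub (D : Type*) [CommRing D] [IsDomain D] (E : Submodule D (FractionRing D)) :
    Submodule D (FractionRing D) :=
  1 / (1 / E)

/-- The `t`-operation: `E^t = ⋃ {F^v : F` a nonzero finitely generated submodule `⊆ E}`,
as a subset of the fraction field. -/
def tSet (D : Type*) [CommRing D] [IsDomain D] (E : Submodule D (FractionRing D)) :
    Set (FractionRing D) :=
  ⋃ F ∈ {F : Submodule D (FractionRing D) | F.FG ∧ F ≠ ⊥ ∧ F ≤ E},
    (vSub D F : Set (FractionRing D))

/-- An integral ideal `I` of `D` is a `t`-ideal if `I^t = I`. -/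
def IsTIdeal (D : Type*) [CommRing D] [IsDomain D] (I : Ideal D) : Prop :=
  tSet D (coeI D I) = (coeI D I : Set (FractionRing D))

/-- A nonzero ideal `I` of `D` is `t`-idempotent if `(I²)^t = I^t`. -/
def TIdem (D : Type*) [CommRing D] [IsDomain D] (I : Ideal D) : Prop :=
  tSet D (coeI D (I * I)) = tSet D (coeI D I)

/-- `D` is a Prüfer `v`-multiplication domain: `(F·F⁻¹)^t = D` for every nonzero
finitely generated ideal `F` of `D`. -/
def IsPvMD (D : Type*) [CommRing D] [IsDomain D] : Prop :=
  ∀ F : Ideal D, F ≠ ⊥ → F.FG →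
    tSet D (coeI D F * (1 / coeI D F)) =
      ((1 : Submodule D (FractionRing D)) : Set (FractionRing D))

/-- A `t`-maximal ideal: an ideal maximal among proper integral `t`-ideals. -/
def IsTMax (D : Type*) [CommRing D] [IsDomain D] (M : Ideal D) : Prop :=
  M ≠ ⊤ ∧ IsTIdeal D M ∧ ∀ J : Ideal D, J ≠ ⊤ → IsTIdeal D J → M ≤ J → J = M

/-- The localization `D_P` of `D` at a prime `P`, viewed as a subset of the fraction field:
the set of fractions `a / s` with `s ∉ P`. -/
def locSet (D : Type*) [CommRing D] [IsDomain D] (P : Ideal D) : Set (FractionRing D) :=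
  {x | ∃ a s : D, s ∉ P ∧ x * algebraMap D (FractionRing D) s = algebraMap D (FractionRing D) a}

/-- A prime `t`-ideal `P` is `t`-sharp if `⋂ {D_M : M t-maximal, M ⊉ P} ⊄ D_P`. -/
def IsTSharp (D : Type*) [CommRing D] [IsDomain D] (P : Ideal D) : Prop :=
  ¬ (⋂ M ∈ {M : Ideal D | IsTMax D M ∧ ¬ P ≤ M}, locSet D M) ⊆ locSet D P

/-- A prime ideal `P` of `D` is branched if there is a `P`-primary ideal distinct from `P`. -/
def IsBranched (D : Type*) [CommRing D] [IsDomain D] (P : Ideal D) : Prop :=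
  ∃ Q : Ideal D, Q.IsPrimary ∧ Q.radical = P ∧ Q ≠ P

/-- `D` has finite `t`-character: every nonzero element lies in only finitely many
`t`-maximal ideals. -/
def FiniteTCharacter (D : Type*) [CommRing D] [IsDomain D] : Prop :=
  ∀ a : D, a ≠ 0 → {M : Ideal D | IsTMax D M ∧ a ∈ M}.Finite

/-- A nonzero ideal `I` of `D` is divisorial if `(I⁻¹)⁻¹ = I`. -/
def IsDivisorial (D : Type*) [CommRing D] [IsDomain D] (I : Ideal D) : Prop :=
  vSub D (coeI D I) = coeI D I


section ContractSpan

variable {D : Type*} [CommRing D]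

/-- The contraction to `D` of the ideal generated by `a` in the localization at the prime `P`. -/
def contractSpan (P : Ideal D) [P.IsPrime] (a : D) : Ideal D where
  carrier := {d | ∃ s ∉ P, a ∣ d * s}
  zero_mem' := ⟨1, Ideal.one_notMem P, by simp⟩
  add_mem' := by
    rintro x y ⟨s, hs, u, hu⟩ ⟨t, ht, v, hv⟩
    refine ⟨s * t, Ideal.IsPrime.mul_notMem ‹_› hs ht, u * t + v * s, ?_⟩
    linear_combination t * hu + s * hv
  smul_mem' := by
    rintro c x ⟨s, hs, u, hu⟩
    exact ⟨s, hs, c * u, by rw [smul_eq_mul]; linear_combination c * hu⟩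

lemma mem_contractSpan_self {P : Ideal D} [P.IsPrime] (a : D) : a ∈ contractSpan P a :=
  ⟨1, Ideal.one_notMem P, by simp⟩

lemma contractSpan_mul_self_le (P : Ideal D) [P.IsPrime] (a : D) :
    contractSpan P a * contractSpan P a ≤ contractSpan P (a * a) := by
  refine Ideal.mul_le.2 ?_
  rintro x ⟨s, hs, u, hu⟩ y ⟨t, ht, v, hv⟩
  refine ⟨s * t, Ideal.IsPrime.mul_notMem ‹_› hs ht, u * v, ?_⟩
  linear_combination (y * t) * hu + (a * u) * hv

end ContractSpan

section TIdeals

variable {D : Type*} [CommRing D] [IsDomain D]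

lemma mem_coeI {I : Ideal D} {x : FractionRing D} :
    x ∈ coeI D I ↔ ∃ d ∈ I, algebraMap D (FractionRing D) d = x := by
  simp [coeI]

lemma algebraMap_mem_coeI {I : Ideal D} {d : D} :
    algebraMap D (FractionRing D) d ∈ coeI D I ↔ d ∈ I := by
  rw [mem_coeI]
  constructor
  · rintro ⟨e, he, h⟩
    rwa [← IsFractionRing.injective D (FractionRing D) h]
  · exact fun h => ⟨d, h, rfl⟩

lemma coeI_mono {I J : Ideal D} (h : I ≤ J) : coeI D I ≤ coeI D J :=
  Submodule.map_mono h

lemma coeI_le_one (I : Ideal D) : coeI D I ≤ 1 := by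
  intro x hx
  obtain ⟨d, -, rfl⟩ := mem_coeI.1 hx
  exact Submodule.mem_one.2 ⟨d, rfl⟩

lemma coeI_ne_bot {I : Ideal D} (h : I ≠ ⊥) : coeI D I ≠ ⊥ := by
  obtain ⟨d, hd, hd0⟩ := Submodule.exists_mem_ne_zero_of_ne_bot h
  refine Submodule.ne_bot_iff _ |>.2 ⟨_, algebraMap_mem_coeI.2 hd, ?_⟩
  simpa using hd0

lemma le_vSub (E : Submodule D (FractionRing D)) : E ≤ vSub D E := by
  intro x hx
  rw [vSub, Submodule.mem_div_iff_forall_mul_mem]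
  intro y hy
  rw [mul_comm]
  exact Submodule.mem_div_iff_forall_mul_mem.1 hy x hx

/-- If multiplication by `y` carries `E` into `D`, then it carries `E^v` into `D`. -/
lemma mul_mem_one_of_mem_vSub {E : Submodule D (FractionRing D)} {x y : FractionRing D}
    (hx : x ∈ vSub D E) (hy : ∀ e ∈ E, y * e ∈ (1 : Submodule D (FractionRing D))) :
    x * y ∈ (1 : Submodule D (FractionRing D)) :=
  Submodule.mem_div_iff_forall_mul_mem.1 hx y (Submodule.mem_div_iff_forall_mul_mem.2 hy)

lemma vSub_le_one {E : Submodule D (FractionRing D)} (h : E ≤ 1) : vSub D E ≤ 1 := by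
  intro x hx
  simpa using mul_mem_one_of_mem_vSub (y := 1) hx (fun e he => by simpa using h he)

lemma mem_tSet {E : Submodule D (FractionRing D)} {x : FractionRing D} :
    x ∈ tSet D E ↔ ∃ F : Submodule D (FractionRing D),
      F.FG ∧ F ≠ ⊥ ∧ F ≤ E ∧ x ∈ vSub D F := by
  simp [tSet, and_assoc]

lemma tSet_mono {E E' : Submodule D (FractionRing D)} (h : E ≤ E') : tSet D E ⊆ tSet D E' := by
  intro x hx
  obtain ⟨F, h1, h2, h3, h4⟩ := mem_tSet.1 hx
  exact mem_tSet.2 ⟨F, h1, h2, h3.trans h, h4⟩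

lemma subset_tSet {E : Submodule D (FractionRing D)} (h : E ≠ ⊥) :
    (E : Set (FractionRing D)) ⊆ tSet D E := by
  have key : ∀ x ∈ E, x ≠ 0 → x ∈ tSet D E := fun x hx hx0 =>
    mem_tSet.2 ⟨Submodule.span D {x}, Submodule.fg_span_singleton x,
      by simpa using hx0, by simpa using hx, le_vSub _ (Submodule.mem_span_singleton_self x)⟩
  intro x hx
  by_cases hx0 : x = 0
  · obtain ⟨y, hy, hy0⟩ := Submodule.exists_mem_ne_zero_of_ne_bot h
    obtain ⟨F, h1, h2, h3, -⟩ := mem_tSet.1 (key y hy hy0)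
    exact mem_tSet.2 ⟨F, h1, h2, h3, hx0 ▸ zero_mem _⟩
  · exact key x hx hx0

lemma isTIdeal_iff {I : Ideal D} : IsTIdeal D I ↔ I ≠ ⊥ ∧
    ∀ F : Submodule D (FractionRing D), F.FG → F ≠ ⊥ → F ≤ coeI D I → vSub D F ≤ coeI D I := by
  constructor
  · intro h
    refine ⟨?_, fun F h1 h2 h3 x hx => ?_⟩
    · rintro rfl
      have h0 : (0 : FractionRing D) ∈ tSet D (coeI D ⊥) := by
        rw [IsTIdeal] at h
        rw [h]
        exact zero_mem _
      obtain ⟨F, -, h2, h3, -⟩ := mem_tSet.1 h0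
      exact h2 (by simpa [coeI] using h3)
    · exact (Set.ext_iff.1 h x).1 (mem_tSet.2 ⟨F, h1, h2, h3, hx⟩)
  · rintro ⟨h0, h⟩
    refine Set.Subset.antisymm (fun x hx => ?_) (subset_tSet (coeI_ne_bot h0))
    obtain ⟨F, h1, h2, h3, h4⟩ := mem_tSet.1 hx
    exact h F h1 h2 h3 h4

/-- The colon ideal of a `t`-ideal by a nonzero element is a `t`-ideal. -/
lemma IsTIdeal.colon {N : Ideal D} (hN : IsTIdeal D N) {b : D} (hb : b ≠ 0) {I : Ideal D}
    (hI : ∀ d, d ∈ I ↔ d * b ∈ N) : IsTIdeal D I := by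
  have hNI : N ≤ I := fun d hd => (hI d).2 (N.mul_mem_right b hd)
  obtain ⟨h0, h⟩ := isTIdeal_iff.1 hN
  refine isTIdeal_iff.2 ⟨fun hbot => h0 (le_bot_iff.1 (hbot ▸ hNI)), fun F h1 h2 h3 x hx => ?_⟩
  obtain ⟨d, rfl⟩ := Submodule.mem_one.1 (vSub_le_one (h3.trans (coeI_le_one _)) hx)
  have hmem := h (F.map (LinearMap.mulLeft D (algebraMap D (FractionRing D) b))) (h1.map _) ?_ ?_
    (x := algebraMap D (FractionRing D) (d * b)) ?_
  · exact algebraMap_mem_coeI.2 ((hI d).2 (algebraMap_mem_coeI.1 hmem))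
  · obtain ⟨y, hy, hy0⟩ := Submodule.exists_mem_ne_zero_of_ne_bot h2
    exact (Submodule.ne_bot_iff _).2
      ⟨_, Submodule.mem_map_of_mem hy, by simpa using And.intro hb hy0⟩
  · rintro _ ⟨y, hy, rfl⟩
    obtain ⟨e, he, rfl⟩ := mem_coeI.1 (h3 hy)
    rw [LinearMap.mulLeft_apply, ← map_mul, mul_comm]
    exact algebraMap_mem_coeI.2 ((hI e).1 he)
  · rw [vSub, Submodule.mem_div_iff_forall_mul_mem]
    intro z hz
    rw [map_mul, mul_assoc]
    refine mul_mem_one_of_mem_vSub hx fun e he => ?_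
    have := Submodule.mem_div_iff_forall_mul_mem.1 hz _ (Submodule.mem_map_of_mem he)
    rw [LinearMap.mulLeft_apply] at this
    convert this using 1
    ring

/-- Every `t`-maximal ideal is prime. -/
lemma IsTMax.isPrime {N : Ideal D} (hN : IsTMax D N) : N.IsPrime := by
  refine ⟨hN.1, fun {x y} hxy => or_iff_not_imp_right.2 fun hy => ?_⟩
  let I : Ideal D := Submodule.comap (LinearMap.mulRight D y) N
  have hI : ∀ d, d ∈ I ↔ d * y ∈ N := fun d => Iff.rfl
  have : I = N := hN.2.2 I (fun h => hy (by simpa using (hI 1).1 (h ▸ trivial)))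
    (hN.2.1.colon (by rintro rfl; exact hy (zero_mem N)) hI) (fun d hd => (hI d).2 (N.mul_mem_right y hd))
  exact this ▸ (hI x).2 hxy

/-- Every proper `t`-ideal is contained in a `t`-maximal ideal. -/
lemma IsTIdeal.exists_le_isTMax {J : Ideal D} (hJ : IsTIdeal D J) (hJ' : J ≠ ⊤) :
    ∃ N, IsTMax D N ∧ J ≤ N := by
  have hub : ∀ c ⊆ {I : Ideal D | I ≠ ⊤ ∧ IsTIdeal D I}, IsChain (· ≤ ·) c → ∀ I ∈ c,
      ∃ L ∈ {I : Ideal D | I ≠ ⊤ ∧ IsTIdeal D I}, ∀ K ∈ c, K ≤ L := by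
    intro c hc hchain I hIc
    have hdir : DirectedOn (· ≤ ·) c := hchain.directedOn
    refine ⟨sSup c, ⟨fun h => ?_, isTIdeal_iff.2 ⟨fun h => ?_, fun F h1 h2 h3 => ?_⟩⟩,
      fun _ => le_sSup⟩
    · obtain ⟨K, hK, h⟩ := (Submodule.mem_sSup_of_directed ⟨I, hIc⟩ hdir).1
        ((Ideal.eq_top_iff_one _).1 h)
      exact (hc hK).1 ((Ideal.eq_top_iff_one _).2 h)
    · exact (isTIdeal_iff.1 (hc hIc).2).1 (le_bot_iff.1 (h ▸ le_sSup hIc))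
    · obtain ⟨K, hK, hFK⟩ : ∃ K ∈ c, F ≤ coeI D K := by
        clear h2
        induction F, h1 using Submodule.fg_induction with
        | singleton x =>
          obtain ⟨d, hd, rfl⟩ := mem_coeI.1 (h3 (Submodule.mem_span_singleton_self x))
          obtain ⟨K, hK, h⟩ := (Submodule.mem_sSup_of_directed ⟨I, hIc⟩ hdir).1 hd
          exact ⟨K, hK, (Submodule.span_singleton_le_iff_mem _ _).2 (algebraMap_mem_coeI.2 h)⟩
        | sup F G _ _ hF hG =>
          obtain ⟨K, hK, hFK⟩ := hF (le_sup_left.trans h3)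
          obtain ⟨L, hL, hGL⟩ := hG (le_sup_right.trans h3)
          obtain ⟨E, hE, hKE, hLE⟩ := hdir K hK L hL
          exact ⟨E, hE, sup_le (hFK.trans (coeI_mono hKE)) (hGL.trans (coeI_mono hLE))⟩
      exact ((isTIdeal_iff.1 (hc hK).2).2 F h1 h2 hFK).trans (coeI_mono (le_sSup hK))
  obtain ⟨N, hJN, hN⟩ := zorn_le_nonempty₀ _ hub J ⟨hJ', hJ⟩
  exact ⟨N, ⟨hN.prop.1, hN.prop.2, fun I h1 h2 h3 => (hN.eq_of_le ⟨h1, h2⟩ h3).symm⟩, hJN⟩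

/-- `D` is the intersection of its localizations at the `t`-maximal ideals. -/
lemma mem_one_of_forall_mem_locSet {x : FractionRing D}
    (hx : ∀ N, IsTMax D N → x ∈ locSet D N) : x ∈ (1 : Submodule D (FractionRing D)) := by
  let J : Ideal D := Submodule.comap (LinearMap.toSpanSingleton D (FractionRing D) x) 1
  have hJ : ∀ d, d ∈ J ↔ x * algebraMap D (FractionRing D) d ∈
      (1 : Submodule D (FractionRing D)) := fun d => by
    rw [mul_comm, ← Algebra.smul_def]; rfl
  by_contra hx1
  have hJt : IsTIdeal D J := by
    refine isTIdeal_iff.2 ⟨?_, fun F h1 h2 h3 y hy => ?_⟩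
    · obtain ⟨a, b, hb, rfl⟩ := IsFractionRing.div_surjective (A := D) x
      have hb0 : b ≠ 0 := nonZeroDivisors.ne_zero hb
      refine (Submodule.ne_bot_iff _).2 ⟨b, (hJ b).2 (Submodule.mem_one.2 ⟨a, ?_⟩), hb0⟩
      rw [div_mul_cancel₀]
      simpa using hb0
    · obtain ⟨d, rfl⟩ := Submodule.mem_one.1 (vSub_le_one (h3.trans (coeI_le_one _)) hy)
      refine algebraMap_mem_coeI.2 ((hJ d).2 ?_)
      rw [mul_comm]
      refine mul_mem_one_of_mem_vSub hy fun e he => ?_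
      obtain ⟨f, hf, rfl⟩ := mem_coeI.1 (h3 he)
      exact (hJ f).1 hf
  obtain ⟨N, hN, hJN⟩ := hJt.exists_le_isTMax fun h => hx1 (by
    simpa using (hJ 1).1 (h ▸ trivial))
  obtain ⟨a, s, hs, h⟩ := hx N hN
  exact hs (hJN ((hJ s).2 (h ▸ Submodule.mem_one.2 ⟨a, rfl⟩)))

/-- In a PvMD, divisibility in the localization at a proper `t`-ideal is total. -/
lemma IsPvMD.dvd_total (hD : IsPvMD D) {M : Ideal D} (hM : IsTIdeal D M) (hM' : M ≠ ⊤) {a b : D}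
    (ha : a ≠ 0) : ∃ s ∉ M, a ∣ b * s ∨ b ∣ a * s := by
  by_contra! hcon
  let F : Ideal D := Ideal.span {a, b}
  have haF : a ∈ F := Ideal.subset_span (by simp)
  have hbF : b ∈ F := Ideal.subset_span (by simp)
  have hF : F ≠ ⊥ := (Submodule.ne_bot_iff _).2 ⟨a, haF, ha⟩
  have hle : coeI D F * (1 / coeI D F) ≤ coeI D M := by
    refine Submodule.mul_le.2 fun x hx g hg => ?_
    have hgF := Submodule.mem_div_iff_forall_mul_mem.1 hg
    obtain ⟨s, hs⟩ := Submodule.mem_one.1 (hgF _ (algebraMap_mem_coeI.2 haF))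
    obtain ⟨c, hc⟩ := Submodule.mem_one.1 (hgF _ (algebraMap_mem_coeI.2 hbF))
    have hsc : b * s = a * c := by
      apply IsFractionRing.injective D (FractionRing D)
      rw [map_mul, map_mul, hs, hc]
      ring
    have hsM : s ∈ M := by
      by_contra h
      exact (hcon s h).1 ⟨c, hsc⟩
    have hcM : c ∈ M := by
      by_contra h
      exact (hcon c h).2 ⟨s, hsc.symm⟩
    obtain ⟨d, hd, rfl⟩ := mem_coeI.1 hx
    obtain ⟨u, v, rfl⟩ := Ideal.mem_span_pair.1 hd
    refine mem_coeI.2 ⟨u * s + v * c,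
      M.add_mem (M.mul_mem_left u hsM) (M.mul_mem_left v hcM), ?_⟩
    simp only [map_add, map_mul, hs, hc]
    ring
  have h1 : (1 : FractionRing D) ∈ tSet D (coeI D F * (1 / coeI D F)) := by
    rw [hD F hF (Submodule.fg_span (by simp))]
    exact Submodule.one_le.1 le_rfl
  have h2 : (1 : FractionRing D) ∈ coeI D M := (Set.ext_iff.1 hM 1).1 (tSet_mono hle h1)
  rw [← map_one (algebraMap D (FractionRing D)), algebraMap_mem_coeI] at h2
  exact hM' ((Ideal.eq_top_iff_one M).2 h2)

/-- A finitely generated submodule of `aD_P ∩ D` is carried into `aD` by a single `s ∉ P`. -/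
lemma exists_mul_mem_of_fg {P : Ideal D} [P.IsPrime] {a : D} {F : Submodule D (FractionRing D)}
    (hF : F.FG) (hle : F ≤ coeI D (contractSpan P a)) :
    ∃ s ∉ P, ∀ x ∈ F, x * algebraMap D (FractionRing D) s ∈ coeI D (Ideal.span {a}) := by
  induction F, hF using Submodule.fg_induction with
  | singleton x =>
    obtain ⟨d, ⟨s, hs, u, hu⟩, rfl⟩ := mem_coeI.1 (hle (Submodule.mem_span_singleton_self x))
    refine ⟨s, hs, fun y hy => ?_⟩
    obtain ⟨c, rfl⟩ := Submodule.mem_span_singleton.1 hy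
    rw [Algebra.smul_def, mul_assoc, ← map_mul, ← map_mul, algebraMap_mem_coeI, hu,
      Ideal.mem_span_singleton]
    exact ⟨c * u, by ring⟩
  | sup F G _ _ hF hG =>
    obtain ⟨s, hs, h1⟩ := hF (le_sup_left.trans hle)
    obtain ⟨t, ht, h2⟩ := hG (le_sup_right.trans hle)
    refine ⟨s * t, Ideal.IsPrime.mul_notMem ‹_› hs ht, fun x hx => ?_⟩
    obtain ⟨y, hy, z, hz, rfl⟩ := Submodule.mem_sup.1 hx
    have e : (y + z) * algebraMap D (FractionRing D) (s * t) =
        t • (y * algebraMap D (FractionRing D) s) + s • (z * algebraMap D (FractionRing D) t) := by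
      simp only [Algebra.smul_def, map_mul]
      ring
    rw [e]
    exact add_mem (Submodule.smul_mem _ _ (h1 y hy)) (Submodule.smul_mem _ _ (h2 z hz))

/-- The contraction of a proper nonzero principal ideal of `D_P` is not `t`-idempotent. -/
lemma not_tIdem_contractSpan {P : Ideal D} [P.IsPrime] {a : D} (ha : a ∈ P) (ha0 : a ≠ 0) :
    ¬ TIdem D (contractSpan P a) := by
  intro h
  have hne : contractSpan P a ≠ ⊥ :=
    (Submodule.ne_bot_iff _).2 ⟨a, mem_contractSpan_self a, ha0⟩
  have hmem := subset_tSet (coeI_ne_bot hne) (algebraMap_mem_coeI.2 (mem_contractSpan_self a))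
  rw [TIdem] at h
  rw [← h] at hmem
  obtain ⟨F, h1, -, h3, h4⟩ := mem_tSet.1 hmem
  obtain ⟨s, hs, hsF⟩ :=
    exists_mul_mem_of_fg h1 (h3.trans (coeI_mono (contractSpan_mul_self_le P a)))
  have haK : algebraMap D (FractionRing D) a ≠ 0 := by simpa using ha0
  obtain ⟨d, hd⟩ := Submodule.mem_one.1 (mul_mem_one_of_mem_vSub
    (y := algebraMap D (FractionRing D) s / algebraMap D (FractionRing D) (a * a)) h4
    fun e he => by
      obtain ⟨c, hc, hce⟩ := mem_coeI.1 (hsF e he)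
      obtain ⟨u, rfl⟩ := Ideal.mem_span_singleton.1 hc
      refine Submodule.mem_one.2 ⟨u, ?_⟩
      rw [div_mul_eq_mul_div, mul_comm _ e, ← hce, map_mul _ (a * a), mul_div_cancel_left₀]
      simpa using ha0)
  have hsd : s = a * d := by
    apply IsFractionRing.injective D (FractionRing D)
    rw [map_mul, hd, map_mul]
    field_simp
  exact hs (hsd ▸ P.mul_mem_right d ha)

end TIdeals

theorem statement12 (D : Type*) [CommRing D] [IsDomain D]
    (hPvMD : IsPvMD D)
    (hidem : ∀ I : Ideal D, I ≠ ⊥ →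
      (1 : Submodule D (FractionRing D)) / coeI D I = 1 → TIdem D I)
    (M : Ideal D) (hM : IsTMax D M) (hbr : IsBranched D M) :
    IsTSharp D M := by
  intro hsharp
  have hMp : M.IsPrime := hM.isPrime
  obtain ⟨Q, hQ, hQM, hne⟩ := hbr
  have hQle : Q ≤ M := hQM ▸ Ideal.le_radical
  obtain ⟨a, haM, haQ⟩ := SetLike.exists_of_lt (lt_of_le_of_ne hQle hne)
  have ha0 : a ≠ 0 := fun h => haQ (h ▸ zero_mem Q)
  have hQI : Q ≤ contractSpan M a := by
    intro q hq
    obtain ⟨s, hs, h | h⟩ := hPvMD.dvd_total hM.2.1 hM.1 (b := q) ha0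
    · exact ⟨s, hs, h⟩
    · rcases (Ideal.isPrimary_iff.1 hQ).2 (Q.mem_of_dvd h hq) with h | h
      · exact absurd h haQ
      · exact absurd (hQM ▸ h) hs
  refine not_tIdem_contractSpan haM ha0 (hidem _
    ((Submodule.ne_bot_iff _).2 ⟨a, mem_contractSpan_self a, ha0⟩) (le_antisymm ?_ ?_))
  · intro x hx
    rw [Submodule.mem_div_iff_forall_mul_mem] at hx
    have hx' : ∀ N, IsTMax D N → ¬ M ≤ N → x ∈ locSet D N := by
      intro N hN hMN
      have hNp := hN.isPrime
      obtain ⟨i, hi, hiN⟩ := SetLike.not_le_iff_exists.1 fun h : contractSpan M a ≤ N =>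
        hMN (hQM ▸ hNp.radical_le_iff.2 (hQI.trans h))
      obtain ⟨d, hd⟩ := Submodule.mem_one.1 (hx _ (algebraMap_mem_coeI.2 hi))
      exact ⟨d, i, hiN, hd.symm⟩
    refine mem_one_of_forall_mem_locSet fun N hN => ?_
    by_cases hMN : M ≤ N
    · rw [hM.2.2 N hN.1 hN.2.1 hMN]
      exact hsharp (Set.mem_iInter₂.2 fun N' hN' => hx' N' hN'.1 hN'.2)
    · exact hx' N hN hMN
  · rw [Submodule.le_div_iff_mul_le, one_mul]
    exact coeI_le_one _

end
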